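/- For every node i_0 ∈ I that has access to Ī, there exists a directed path ⟨i_0, i_1, …, i_s⟩ in E with i_1, …, i_{s−1} ∈ I and i_s ∈ Ī such that v_{i_0} > v_{i_1} > … > v_{i_s}. -/

import Mathlib

open Matrix Finset

/-- Outdegree of node `i` in the edge set `E`. -/
def outdeg {n : ℕ} (E : Finset (Fin n × Fin n)) (i : Fin n) : ℕ :=
  (Finset.univ.filter (fun j => (i, j) ∈ E)).card

/-- The scaled adjacency matrix `P` of the graph: `P i j = 1 / outdeg i` if `(i,j) ∈ E`. -/
noncomputable def Pmat {n : ℕ} (E : Finset (Fin n × Fin n)) : Matrix (Fin n) (Fin n) ℝ :=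
  fun i j => if (i, j) ∈ E then ((outdeg E i : ℝ))⁻¹ else 0

/-- Indicator vector of a set of nodes. -/
def ind {n : ℕ} (I : Finset (Fin n)) : Fin n → ℝ :=
  fun i => if i ∈ I then 1 else 0

/-- `v = (Id - cP)⁻¹ e_I`, the vector of mean numbers of visits to `I` before zapping. -/
noncomputable def vvec {n : ℕ} (c : ℝ) (E : Finset (Fin n × Fin n)) (I : Finset (Fin n)) : Fin n → ℝ :=
  (1 - c • Pmat E)⁻¹ *ᵥ ind I

/-- PageRank vector `πᵀ = (1-c) zᵀ (Id - cP)⁻¹`. -/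
noncomputable def pr {n : ℕ} (c : ℝ) (z : Fin n → ℝ) (E : Finset (Fin n × Fin n)) : Fin n → ℝ :=
  (1 - c) • (((1 - c • Pmat E)⁻¹)ᵀ *ᵥ z)

/-- PageRank of the set `I`: `πᵀ e_I`. -/
noncomputable def prSet {n : ℕ} (c : ℝ) (z : Fin n → ℝ) (E : Finset (Fin n × Fin n))
    (I : Finset (Fin n)) : ℝ :=
  ∑ i ∈ I, pr c z E i

/-- Node `i` has access to (some node of) the set `J`: `i ∈ J` or a directed path from `i`
reaches `J`. -/
def access {n : ℕ} (E : Finset (Fin n × Fin n)) (i : Fin n) (J : Finset (Fin n)) : Prop :=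
  ∃ j ∈ J, Relation.ReflTransGen (fun a b => (a, b) ∈ E) i j

theorem Pmat_nonneg {n : ℕ} (E : Finset (Fin n × Fin n)) (i j : Fin n) : 0 ≤ Pmat E i j := by
  unfold Pmat
  split_ifs <;> positivity

theorem Pmat_pos {n : ℕ} (E : Finset (Fin n × Fin n)) (hE : ∀ i, 0 < outdeg E i) (i j : Fin n)
    (h : (i, j) ∈ E) : 0 < Pmat E i j := by
  have : (0 : ℝ) < outdeg E i := by exact_mod_cast hE i
  simp only [Pmat, h, if_true]
  positivity

theorem Pmat_sum {n : ℕ} (E : Finset (Fin n × Fin n)) (hE : ∀ i, 0 < outdeg E i) (i : Fin n) :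
    ∑ j, Pmat E i j = 1 := by
  have : (0 : ℝ) < outdeg E i := by exact_mod_cast hE i
  simp only [Pmat]
  rw [← Finset.sum_filter, Finset.sum_const, nsmul_eq_mul]
  exact mul_inv_cancel₀ this.ne'

theorem Pmat_avg_le {n : ℕ} (E : Finset (Fin n × Fin n)) (hE : ∀ i, 0 < outdeg E i) (i : Fin n)
    (x : Fin n → ℝ) (M : ℝ) (h : ∀ j, x j ≤ M) : ∑ j, Pmat E i j * x j ≤ M := by
  calc ∑ j, Pmat E i j * x j ≤ ∑ j, Pmat E i j * M :=
        Finset.sum_le_sum fun j _ => mul_le_mul_of_nonneg_left (h j) (Pmat_nonneg E i j)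
    _ = M := by rw [← Finset.sum_mul, Pmat_sum E hE, one_mul]

theorem max_principle {n : ℕ} (E : Finset (Fin n × Fin n)) (hE : ∀ i, 0 < outdeg E i)
    (c : ℝ) (hc0 : 0 < c) (hc1 : c < 1) (x : Fin n → ℝ) (a : ℝ)
    (h : ∀ i, x i ≤ a + c * ∑ j, Pmat E i j * x j) (i : Fin n) : x i ≤ a / (1 - c) := by
  have : Nonempty (Fin n) := ⟨i⟩
  obtain ⟨m, hm⟩ := Finite.exists_max x
  have h1 := Pmat_avg_le E hE m x (x m) hm
  have h2 := h m
  have h3 := mul_le_mul_of_nonneg_left h1 hc0.le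
  refine (hm i).trans ?_
  rw [le_div_iff₀ (by linarith)]
  nlinarith

theorem vvec_eq {n : ℕ} (E : Finset (Fin n × Fin n)) (hE : ∀ i, 0 < outdeg E i)
    (c : ℝ) (hc0 : 0 < c) (hc1 : c < 1) (I : Finset (Fin n)) (i : Fin n) :
    vvec c E I i = ind I i + c * ∑ j, Pmat E i j * vvec c E I j := by
  have key : ∀ x : Fin n → ℝ, ∀ i, ((1 - c • Pmat E) *ᵥ x) i
      = x i - c * ∑ j, Pmat E i j * x j := by
    intro x i
    rw [Matrix.sub_mulVec, Matrix.one_mulVec, Matrix.smul_mulVec]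
    rfl
  have hdet : (1 - c • Pmat E).det ≠ 0 := by
    intro h0
    obtain ⟨x, hx, hx0⟩ := Matrix.exists_mulVec_eq_zero_iff.mpr h0
    apply hx
    have hk : ∀ i, x i - c * ∑ j, Pmat E i j * x j = 0 := by
      intro i
      rw [← key, hx0]; rfl
    funext i
    have h1 := max_principle E hE c hc0 hc1 x 0 (fun i => by linarith [hk i]) i
    have h2 := max_principle E hE c hc0 hc1 (fun j => - x j) 0 (fun i => by
      have := hk i
      simp only [mul_neg, Finset.sum_neg_distrib]
      linarith) i
    simp only [zero_div] at h1 h2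
    simp only [Pi.zero_apply]
    linarith
  have h : (1 - c • Pmat E) *ᵥ vvec c E I = ind I := by
    rw [vvec, Matrix.mulVec_mulVec, Matrix.mul_nonsing_inv _ (isUnit_iff_ne_zero.mpr hdet),
      Matrix.one_mulVec]
  have := key (vvec c E I) i
  rw [h] at this
  linarith

/-- Lemma 3 (Decreasing paths to the complement of I): from every node of `I` having
access to the complement of `I`, there is a directed path staying in `I` until its last
node, which lies outside `I`, along which `v` strictly decreases. -/
theorem stmt4 {n : ℕ} (hn : 1 ≤ n) (E : Finset (Fin n × Fin n))
    (hE : ∀ i, 0 < outdeg E i) (c : ℝ) (hc0 : 0 < c) (hc1 : c < 1)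
    (I : Finset (Fin n)) :
    ∀ i₀ ∈ I, access E i₀ Iᶜ →
      ∃ (s : ℕ) (p : ℕ → Fin n), 0 < s ∧ p 0 = i₀ ∧
        (∀ k, k < s → (p k, p (k + 1)) ∈ E) ∧
        (∀ k, k < s → p k ∈ I) ∧
        p s ∉ I ∧
        (∀ k, k < s → vvec c E I (p (k + 1)) < vvec c E I (p k)) := by
  have hv := vvec_eq E hE c hc0 hc1 I
  set v := vvec c E I with hvdef
  have h1c : 0 < 1 - c := by linarith
  set M : ℝ := 1 / (1 - c) with hM
  have hMe : M = 1 + c * M := by rw [hM]; field_simp; ring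
  have hind : ∀ i, ind I i ≤ 1 := by
    intro i; unfold ind; split_ifs <;> norm_num
  have hle : ∀ i, v i ≤ M := max_principle E hE c hc0 hc1 v 1
    (fun i => by linarith [hv i, hind i])
  have hacc : ∀ i, access E i Iᶜ → v i < M := by
    rintro i ⟨j, hj, hr⟩
    induction hr using Relation.ReflTransGen.head_induction_on with
    | refl =>
      have h0 : ind I j = 0 := by simp only [ind, Finset.mem_compl.mp hj, if_false]
      have h1 := mul_le_mul_of_nonneg_left (Pmat_avg_le E hE j v M hle) hc0.le
      linarith [hv j]
    | head hab hbj ih =>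
      rename_i a b
      have h1 : ∑ j, Pmat E a j * v j < ∑ j, Pmat E a j * M :=
        Finset.sum_lt_sum
          (fun j _ => mul_le_mul_of_nonneg_left (hle j) (Pmat_nonneg E a j))
          ⟨b, Finset.mem_univ _, mul_lt_mul_of_pos_left ih (Pmat_pos E hE a b hab)⟩
      rw [← Finset.sum_mul, Pmat_sum E hE, one_mul] at h1
      have h2 := mul_lt_mul_of_pos_left h1 hc0
      linarith [hv a, hind a]
  have hstep : ∀ i ∈ I, v i < M → ∃ j, (i, j) ∈ E ∧ v j < v i := by
    intro i hi hlt
    by_contra! hcon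
    have h1 : ∑ j, Pmat E i j * v i ≤ ∑ j, Pmat E i j * v j := by
      refine Finset.sum_le_sum fun j _ => ?_
      by_cases hj : (i, j) ∈ E
      · exact mul_le_mul_of_nonneg_left (hcon j hj) (Pmat_nonneg E i j)
      · simp [Pmat, hj]
    rw [← Finset.sum_mul, Pmat_sum E hE, one_mul] at h1
    have h0 : ind I i = 1 := by simp only [ind, hi, if_true]
    have h2 := mul_le_mul_of_nonneg_left h1 hc0.le
    have h3 := hv i
    nlinarith
  have hmain : ∀ i, i ∈ I → v i < M → ∃ (s : ℕ) (p : ℕ → Fin n), 0 < s ∧ p 0 = i ∧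
        (∀ k, k < s → (p k, p (k + 1)) ∈ E) ∧
        (∀ k, k < s → p k ∈ I) ∧
        p s ∉ I ∧
        (∀ k, k < s → v (p (k + 1)) < v (p k)) := by
    have wf : WellFounded (fun a b : Fin n => v a < v b) :=
      @Finite.wellFounded_of_trans_of_irrefl _ _ _ ⟨fun _ _ _ => lt_trans⟩
        ⟨fun _ => lt_irrefl _⟩
    intro i
    induction i using wf.induction with
    | _ i ih =>
      intro hi hlt
      obtain ⟨j, hj, hji⟩ := hstep i hi hlt
      by_cases hjI : j ∈ I
      · obtain ⟨s, p, hs, hp0, hpE, hpI, hps, hpv⟩ := ih j hji hjI (hji.trans hlt)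
        refine ⟨s + 1, fun k => Nat.casesOn k i p, Nat.succ_pos _, rfl, ?_, ?_, hps, ?_⟩
        · rintro (_ | k) hk
          · simpa [hp0] using hj
          · exact hpE k (by omega)
        · rintro (_ | k) hk
          · exact hi
          · exact hpI k (by omega)
        · rintro (_ | k) hk
          · simpa [hp0] using hji
          · exact hpv k (by omega)
      · refine ⟨1, fun k => Nat.casesOn k i (fun _ => j), one_pos, rfl, ?_, ?_, hjI, ?_⟩
        all_goals
          intro k hk
          obtain rfl : k = 0 := by omega
          assumption
  intro i hi ha
  exact hmain i hi (hacc i ha)
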